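/- arXiv:2410.19891 — 5 statements merged into one kernel-verified Lean document; each statement's English description precedes it below -/
import Mathlib

section
/- Let n ∈ ℕ and E = EuclideanSpace ℝ (Fin n). Let φ : ℝ × E → ℝ, u : ℝ × E → E, J : ℝ × E → ℝ and r : ℝ → ℝ. Fix (t₀, x₀) ∈ ℝ × E and assume: φ is differentiable at (t₀, x₀); r is differentiable at φ(t₀, x₀); the map x ↦ u(t₀, x) is differentiable at x₀; the order-parameter equation ∂_t φ(t₀,x₀) + ⟨u(t₀,x₀), ∇_x φ(t₀,x₀)⟩ = J(t₀,x₀) holds; the velocity field is solenoidal at the point, div_x u(t₀, x₀) = 0; and the continuity equation ∂_t (r∘φ)(t₀,x₀) + div_x ((r∘φ)·u)(t₀,x₀) = 0 holds (with r∘φ the density ρ = r(φ)). Then r'(φ(t₀,x₀)) · J(t₀,x₀) = 0. -/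
open scoped RealInnerProductSpace

/-- Divergence of a spatial vector field at a point. -/
noncomputable def spaceDiv {n : ℕ}
    (v : EuclideanSpace ℝ (Fin n) → EuclideanSpace ℝ (Fin n))
    (x : EuclideanSpace ℝ (Fin n)) : ℝ :=
  ∑ i : Fin n, fderiv ℝ (fun y => v y i) x (EuclideanSpace.single i 1)

/-- Product rule for the divergence of a scalar field times a vector field. -/
theorem spaceDiv_smul {n : ℕ}
    {f : EuclideanSpace ℝ (Fin n) → ℝ}
    {v : EuclideanSpace ℝ (Fin n) → EuclideanSpace ℝ (Fin n)}
    {x : EuclideanSpace ℝ (Fin n)}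
    (hf : DifferentiableAt ℝ f x) (hv : DifferentiableAt ℝ v x) :
    spaceDiv (fun y => f y • v y) x = f x * spaceDiv v x + fderiv ℝ f x (v x) := by
  have hvi : ∀ i, DifferentiableAt ℝ (fun y => v y i) x := differentiableAt_euclidean.1 hv
  have hexp : v x = ∑ i, v x i • EuclideanSpace.single i (1 : ℝ) := by
    simpa using ((EuclideanSpace.basisFun (Fin n) ℝ).sum_repr (v x)).symm
  have hfd : fderiv ℝ f x (v x)
      = ∑ i, v x i * fderiv ℝ f x (EuclideanSpace.single i 1) := by
    conv_lhs => rw [hexp]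
    simp only [map_sum, map_smul, smul_eq_mul]
  rw [hfd, spaceDiv, spaceDiv, Finset.mul_sum, ← Finset.sum_add_distrib]
  refine Finset.sum_congr rfl fun i _ => ?_
  simp only [PiLp.smul_apply, smul_eq_mul]
  rw [fderiv_fun_mul hf (hvi i)]
  simp

/-- If the order parameter evolves by `∂ₜφ + u·∇φ = J`, the density is `ρ = r ∘ φ`,
the velocity field is solenoidal at the point, and the continuity equation holds
at the point, then `r'(φ)·J = 0` there. -/
theorem density_function_incompressible_continuity
    {n : ℕ}
    (φ : ℝ × EuclideanSpace ℝ (Fin n) → ℝ)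
    (u : ℝ × EuclideanSpace ℝ (Fin n) → EuclideanSpace ℝ (Fin n))
    (J : ℝ × EuclideanSpace ℝ (Fin n) → ℝ)
    (r : ℝ → ℝ)
    (t₀ : ℝ) (x₀ : EuclideanSpace ℝ (Fin n))
    (hφ : DifferentiableAt ℝ φ (t₀, x₀))
    (hr : DifferentiableAt ℝ r (φ (t₀, x₀)))
    (hu : DifferentiableAt ℝ (fun x => u (t₀, x)) x₀)
    (hevol : deriv (fun t => φ (t, x₀)) t₀
        + ⟪u (t₀, x₀), gradient (fun x => φ (t₀, x)) x₀⟫ = J (t₀, x₀))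
    (hdiv : spaceDiv (fun x => u (t₀, x)) x₀ = 0)
    (hcont : deriv (fun t => r (φ (t, x₀))) t₀
        + spaceDiv (fun x => r (φ (t₀, x)) • u (t₀, x)) x₀ = 0) :
    deriv r (φ (t₀, x₀)) * J (t₀, x₀) = 0 := by
  have hφt : DifferentiableAt ℝ (fun t => φ (t, x₀)) t₀ :=
    hφ.comp t₀ (differentiableAt_id.prodMk (differentiableAt_const x₀))
  have hφx : DifferentiableAt ℝ (fun x => φ (t₀, x)) x₀ :=
    hφ.comp x₀ ((differentiableAt_const t₀).prodMk differentiableAt_id)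
  have hrt : deriv (fun t => r (φ (t, x₀))) t₀
      = deriv r (φ (t₀, x₀)) * deriv (fun t => φ (t, x₀)) t₀ :=
    (hr.hasDerivAt.comp t₀ hφt.hasDerivAt).deriv
  have hrx : HasFDerivAt (fun x => r (φ (t₀, x)))
      (deriv r (φ (t₀, x₀)) • fderiv ℝ (fun x => φ (t₀, x)) x₀) x₀ :=
    hr.hasDerivAt.comp_hasFDerivAt x₀ hφx.hasFDerivAt
  have hgrad : ⟪u (t₀, x₀), gradient (fun x => φ (t₀, x)) x₀⟫
      = fderiv ℝ (fun x => φ (t₀, x)) x₀ (u (t₀, x₀)) := by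
    rw [real_inner_comm, gradient, InnerProductSpace.toDual_symm_apply]
  rw [hrt, spaceDiv_smul hrx.differentiableAt hu, hdiv, hrx.fderiv] at hcont
  rw [← hevol, hgrad]
  simpa [mul_add] using hcont
end

section
/- Let H > 0, G ∈ ℝ, and let μ : ℝ → ℝ be continuous on [−H, H] with μ(y) > 0 for all y ∈ [−H, H]. Define I(y) = ∫_{−H}^{y} (1/μ(t)) dt and I_y(y) = ∫_{−H}^{y} (t/μ(t)) dt (interval integrals), and define u : ℝ → ℝ by u(y) = G·[ (I_y(H) − I_y(y)) + (I_y(H)/I(H))·(I(y) − I(H)) ]. Then: (i) I(H) > 0; (ii) u(−H) = 0 and u(H) = 0; (iii) for every y ∈ (−H, H), u has derivative u'(y) = G·(I_y(H)/I(H) − y)/μ(y) at y (so the viscous stress μ(y)·u'(y) = G·(I_y(H)/I(H) − y) is an affine function of y whose derivative is −G, i.e. u solves the steady layered-Poiseuille equation d/dy(μ du/dy) + G = 0 with no-slip boundary conditions). -/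
open intervalIntegral

/-- The interval integral of a function continuous on `[a, b]` is differentiable in its upper
endpoint at every interior point. -/
theorem hasDerivAt_integral_of_continuousOn_Icc {f : ℝ → ℝ} {a b y : ℝ}
    (hf : ContinuousOn f (Set.Icc a b)) (hy : y ∈ Set.Ioo a b) :
    HasDerivAt (fun x => ∫ t in a..x, f t) (f y) y := by
  have hsub : Set.uIcc a y ⊆ Set.Icc a b := by
    rw [Set.uIcc_of_le hy.1.le]
    exact Set.Icc_subset_Icc_right hy.2.le
  have hf' : ContinuousOn f (Set.Ioo a b) := hf.mono Set.Ioo_subset_Icc_self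
  exact integral_hasDerivAt_right (hf.mono hsub).intervalIntegrable
    (hf'.stronglyMeasurableAtFilter isOpen_Ioo y hy)
    (hf'.continuousAt (isOpen_Ioo.mem_nhds hy))

/-- The explicit formula built from the integrals `I` and `I_y` of `1/μ` and `y/μ`
solves the steady layered-Poiseuille problem: no-slip boundary conditions hold and
the viscous stress `μ u'` is affine with slope `−G`. -/
theorem layered_poiseuille_explicit_solution
    (H G : ℝ) (hH : 0 < H) (μ : ℝ → ℝ)
    (hμc : ContinuousOn μ (Set.Icc (-H) H))
    (hμpos : ∀ y ∈ Set.Icc (-H) H, 0 < μ y)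
    (I Iy : ℝ → ℝ)
    (hI : I = fun y => ∫ t in (-H)..y, 1 / μ t)
    (hIy : Iy = fun y => ∫ t in (-H)..y, t / μ t)
    (u : ℝ → ℝ)
    (hu : u = fun y => G * ((Iy H - Iy y) + (Iy H / I H) * (I y - I H))) :
    0 < I H ∧
    (u (-H) = 0 ∧ u H = 0) ∧
    (∀ y ∈ Set.Ioo (-H) H, HasDerivAt u (G * (Iy H / I H - y) / μ y) y) := by
  have hne : ∀ y ∈ Set.Icc (-H) H, μ y ≠ 0 := fun y hy => (hμpos y hy).ne'
  have hinv : ContinuousOn (fun t => 1 / μ t) (Set.Icc (-H) H) :=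
    continuousOn_const.div hμc hne
  have hmom : ContinuousOn (fun t => t / μ t) (Set.Icc (-H) H) :=
    continuousOn_id.div hμc hne
  have hIpos : 0 < I H := by
    rw [hI]
    refine intervalIntegral_pos_of_pos_on ?_ (fun t ht => ?_) (by linarith)
    · exact hinv.intervalIntegrable_of_Icc (by linarith)
    · exact one_div_pos.2 (hμpos t (Set.Ioo_subset_Icc_self ht))
  have hI0 : I (-H) = 0 := by simp [hI]
  have hIy0 : Iy (-H) = 0 := by simp [hIy]
  refine ⟨hIpos, ⟨?_, ?_⟩, fun y hy => ?_⟩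
  · simp only [hu, hI0, hIy0]
    field_simp
    ring
  · simp [hu]
  · have hdI : HasDerivAt I (1 / μ y) y := by
      rw [hI]
      exact hasDerivAt_integral_of_continuousOn_Icc hinv hy
    have hdIy : HasDerivAt Iy (y / μ y) y := by
      rw [hIy]
      exact hasDerivAt_integral_of_continuousOn_Icc hmom hy
    rw [hu]
    refine (((hdIy.const_sub (Iy H)).add
      ((hdI.sub_const (I H)).const_mul (Iy H / I H))).const_mul G).congr_deriv ?_
    ring
end

section
/- Let W > 0 and μ_A, μ_B > 0, and let μ : ℝ → ℝ be the linear (M2) mixture viscosity profile μ(y) = (1/2)·[(μ_A + μ_B) + (μ_A − μ_B)·tanh(2y/W)]. Then μ(y) > 0 for all y, and for every y ∈ ℝ, ∫_0^y (1/μ(t)) dt = (1/(4 μ_A μ_B)) · [ 2(μ_A + μ_B)·y + (μ_B − μ_A)·W·ln( (μ_A·exp(2y/W) + μ_B·exp(−2y/W)) / (μ_A + μ_B) ) ]. -/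
open intervalIntegral

/-- The linear mixture of two viscosities by `tanh` as a quotient of exponential sums. -/
lemma linear_mixture_tanh_eq_div (a b s : ℝ) :
    (1 / 2) * ((a + b) + (a - b) * Real.tanh s)
      = (a * Real.exp s + b * Real.exp (-s)) / (Real.exp s + Real.exp (-s)) := by
  have h : Real.exp s + Real.exp (-s) ≠ 0 := by positivity
  rw [Real.tanh_eq_sinh_div_cosh, Real.sinh_eq, Real.cosh_eq]
  field_simp
  ring

/-- An antiderivative of the reciprocal of the linear mixture viscosity. -/
lemma hasDerivAt_linear_mixture_antideriv {W a b : ℝ} (hW : 0 < W) (ha : 0 < a) (hb : 0 < b)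
    (t : ℝ) :
    HasDerivAt (fun y => (1 / (4 * a * b)) * (2 * (a + b) * y + (b - a) * W *
        Real.log ((a * Real.exp (2 * y / W) + b * Real.exp (-(2 * y / W))) / (a + b))))
      ((Real.exp (2 * t / W) + Real.exp (-(2 * t / W))) /
        (a * Real.exp (2 * t / W) + b * Real.exp (-(2 * t / W)))) t := by
  have hs : HasDerivAt (fun y : ℝ => 2 * y / W) (2 / W) t := by
    simpa using ((hasDerivAt_id t).const_mul 2).div_const W
  have hD := ((hs.exp.const_mul a).add (hs.neg.exp.const_mul b)).div_const (a + b)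
  have hpos : 0 < a * Real.exp (2 * t / W) + b * Real.exp (-(2 * t / W)) := by positivity
  have hlog := hD.log (div_pos hpos (add_pos ha hb)).ne'
  have hF := (((hasDerivAt_id t).const_mul (2 * (a + b))).add
    (hlog.const_mul ((b - a) * W))).const_mul (1 / (4 * a * b))
  refine hF.congr_deriv ?_
  simp only [Pi.add_apply, Pi.neg_apply]
  generalize Real.exp (2 * t / W) = p at *
  generalize Real.exp (-(2 * t / W)) = q at *
  have hab : a + b ≠ 0 := by positivity
  have hpq := hpos.ne'
  field_simp
  ring

/-- Positivity and the closed form of `∫₀^y 1/μ` for the linear (M2) mixture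
viscosity model. -/
theorem M2_linear_viscosity_integral
    (W μA μB : ℝ) (hW : 0 < W) (hμA : 0 < μA) (hμB : 0 < μB)
    (μ : ℝ → ℝ)
    (hμ : μ = fun y =>
      (1 / 2) * ((μA + μB) + (μA - μB) * Real.tanh (2 * y / W))) :
    (∀ y : ℝ, 0 < μ y) ∧
    ∀ y : ℝ,
      (∫ t in (0:ℝ)..y, 1 / μ t)
        = (1 / (4 * μA * μB)) *
            (2 * (μA + μB) * y
              + (μB - μA) * W *
                Real.log ((μA * Real.exp (2 * y / W)
                  + μB * Real.exp (-(2 * y / W))) / (μA + μB))) := by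
  subst hμ
  simp only [linear_mixture_tanh_eq_div]
  refine ⟨fun y => by positivity, fun y => ?_⟩
  simp only [one_div_div]
  rw [integral_eq_sub_of_hasDerivAt
    (fun t _ => hasDerivAt_linear_mixture_antideriv hW hμA hμB t)]
  · simp [(add_pos hμA hμB).ne']
  · refine Continuous.intervalIntegrable ?_ _ _
    refine Continuous.div (by fun_prop) (by fun_prop) fun t => ?_
    positivity
end

section
/- Let r > 0 and y ∈ ℝ with y ≠ 0. Then the coefficient f*(W) = 2(1 − r)·(1 − tanh(2y/W)²) / ( W·((1 + r) + (1 − r)·tanh(2y/W)) ) tends to 0 as W → 0⁺; that is, Tendsto (fun W => 2(1 − r)(1 − tanh(2y/W)²)/(W·((1+r) + (1−r)·tanh(2y/W)))) (𝓝[>] 0) (𝓝 0). (This is the sharp-interface limit of the first-order coefficient f* in the dimensionless layered-Poiseuille momentum equation, common to the M1 and M2 viscosity models, away from the interface y = 0.) -/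
open Filter Topology

theorem Real.abs_le_cosh (x : ℝ) : |x| ≤ Real.cosh x := by
  rw [← Real.cosh_abs]
  exact (Real.self_le_sinh_iff.2 (abs_nonneg x)).trans (Real.sinh_lt_cosh _).le

theorem Real.one_sub_tanh_sq (x : ℝ) : 1 - Real.tanh x ^ 2 = 1 / Real.cosh x ^ 2 := by
  have h := (Real.cosh_pos x).ne'
  rw [Real.tanh_eq_sinh_div_cosh]
  field_simp
  linarith [Real.cosh_sq_sub_sinh_sq x]

theorem Real.one_sub_tanh_sq_le {x : ℝ} (hx : x ≠ 0) : 1 - Real.tanh x ^ 2 ≤ 1 / x ^ 2 := by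
  rw [Real.one_sub_tanh_sq]
  have hpos : 0 < x ^ 2 := by positivity
  refine one_div_le_one_div_of_le hpos ?_
  rw [← sq_abs x]
  gcongr
  exact Real.abs_le_cosh x

/-- A convex combination of `2` and `2 * r` is at least twice the smaller of `1` and `r`. -/
theorem two_mul_min_le_add_mul {r t : ℝ} (ht₁ : -1 ≤ t) (ht₂ : t ≤ 1) :
    2 * min 1 r ≤ (1 + r) + (1 - r) * t := by
  nlinarith [mul_nonneg (sub_nonneg.2 (min_le_left 1 r)) (by linarith : 0 ≤ 1 + t),
    mul_nonneg (sub_nonneg.2 (min_le_right 1 r)) (by linarith : 0 ≤ 1 - t)]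

/-- Sharp-interface limit of the first-order coefficient `f*` in the
dimensionless layered-Poiseuille momentum equation (M1/M2 models), away from
the interface: it tends to `0` as `W → 0⁺`. -/
theorem fstar_sharp_interface_limit
    (r y : ℝ) (hr : 0 < r) (hy : y ≠ 0) :
    Tendsto
      (fun W : ℝ =>
        2 * (1 - r) * (1 - Real.tanh (2 * y / W) ^ 2)
          / (W * ((1 + r) + (1 - r) * Real.tanh (2 * y / W))))
      (𝓝[>] 0) (𝓝 0) := by
  have hm : 0 < min 1 r := lt_min one_pos hr
  have hlim : Tendsto (fun W : ℝ => |2 * (1 - r)| / (4 * y ^ 2 * (2 * min 1 r)) * W)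
      (𝓝[>] 0) (𝓝 0) := by
    refine tendsto_nhdsWithin_of_tendsto_nhds ?_
    exact Continuous.tendsto' (by fun_prop) 0 0 (mul_zero _)
  refine squeeze_zero_norm' ?_ hlim
  filter_upwards [self_mem_nhdsWithin] with W hW
  have hW : 0 < W := hW
  have hsech : 0 ≤ 1 - Real.tanh (2 * y / W) ^ 2 := by
    rw [Real.one_sub_tanh_sq]
    positivity
  have hden := two_mul_min_le_add_mul (r := r) (Real.neg_one_lt_tanh (2 * y / W)).le
    (Real.tanh_lt_one (2 * y / W)).le
  have hden_pos := (mul_pos two_pos hm).trans_le hden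
  rw [Real.norm_eq_abs, abs_div, abs_mul, abs_of_nonneg hsech, abs_of_pos (mul_pos hW hden_pos)]
  calc |2 * (1 - r)| * (1 - Real.tanh (2 * y / W) ^ 2)
        / (W * ((1 + r) + (1 - r) * Real.tanh (2 * y / W)))
      ≤ |2 * (1 - r)| * (1 / (2 * y / W) ^ 2) / (W * (2 * min 1 r)) := by
        gcongr
        exact Real.one_sub_tanh_sq_le (by positivity)
    _ = |2 * (1 - r)| / (4 * y ^ 2 * (2 * min 1 r)) * W := by
        field_simp
        ring
end

section
/- Let r > 0. For W > 0 define N(W) = ∫_{−1}^{1} r^{tanh(2Y/W)/2}·Y dY and D(W) = ∫_{−1}^{1} r^{tanh(2Y/W)/2} dY (interval integrals, with r^x = exp(x·ln r) the real power). Then the normalized interfacial viscous stress of the M3 model, τ*(W) = N(W)/D(W), tends to (r − 1)/(2(r + 1)) as W → 0⁺; that is, Tendsto (fun W => N(W)/D(W)) (𝓝[>] 0) (𝓝 ((r − 1)/(2(r + 1)))). -/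
open Filter Topology intervalIntegral

theorem continuous_real_tanh : Continuous Real.tanh := by
  rw [show Real.tanh = fun x => Real.sinh x / Real.cosh x from
    funext Real.tanh_eq_sinh_div_cosh]
  exact Real.continuous_sinh.div Real.continuous_cosh fun x => (Real.cosh_pos x).ne'

theorem tendsto_tanh_atTop_nhds_one : Tendsto Real.tanh atTop (𝓝 1) := by
  have hform (x : ℝ) : Real.tanh x = 1 - 2 / (Real.exp (2 * x) + 1) := by
    have hexp : Real.exp (2 * x) = Real.exp x * Real.exp x := by rw [two_mul, Real.exp_add]
    rw [Real.tanh_eq_sinh_div_cosh, Real.sinh_eq, Real.cosh_eq, hexp, Real.exp_neg]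
    have := Real.exp_pos x
    field_simp
    ring
  have hden : Tendsto (fun x : ℝ => Real.exp (2 * x) + 1) atTop atTop :=
    tendsto_atTop_add_const_right _ _
      (Real.tendsto_exp_atTop.comp (tendsto_id.const_mul_atTop two_pos))
  simpa [funext hform] using (tendsto_const_nhds (x := (1 : ℝ))).sub (hden.const_div_atTop 2)

theorem tendsto_tanh_atBot_nhds_neg_one : Tendsto Real.tanh atBot (𝓝 (-1)) := by
  simpa [Function.comp_def] using (tendsto_tanh_atTop_nhds_one.comp tendsto_neg_atBot_atTop).neg

theorem tendsto_tanh_div_nhdsGT_zero {Y : ℝ} (hY : Y ≠ 0) :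
    Tendsto (fun W : ℝ => Real.tanh (2 * Y / W)) (𝓝[>] 0) (𝓝 (Real.sign Y)) := by
  simp only [div_eq_mul_inv]
  rcases hY.lt_or_gt with h | h
  · rw [Real.sign_of_neg h]
    exact tendsto_tanh_atBot_nhds_neg_one.comp
      (tendsto_inv_nhdsGT_zero.const_mul_atTop_of_neg (by linarith))
  · rw [Real.sign_of_pos h]
    exact tendsto_tanh_atTop_nhds_one.comp
      (tendsto_inv_nhdsGT_zero.const_mul_atTop (by linarith))

theorem rpow_tanh_div_two_le {r : ℝ} (hr : 0 < r) (x : ℝ) :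
    r ^ (Real.tanh x / 2) ≤ Real.exp |Real.log r| := by
  rw [Real.rpow_def_of_pos hr, Real.exp_le_exp]
  have ht : |Real.tanh x / 2| ≤ 1 := by
    rw [abs_div, abs_two]
    linarith [Real.abs_tanh_lt_one x]
  calc Real.log r * (Real.tanh x / 2) ≤ |Real.log r| * |Real.tanh x / 2| := by
        rw [← abs_mul]
        exact le_abs_self _
    _ ≤ |Real.log r| := mul_le_of_le_one_right (abs_nonneg _) ht

/-- As `W → 0⁺`, the weight `r ^ (tanh (2Y/W) / 2)` can be replaced under the integral by its
pointwise limit `r ^ (sign Y / 2)`. -/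
theorem tendsto_integral_rpow_tanh_mul {r : ℝ} (hr : 0 < r) {g : ℝ → ℝ} (hg : Continuous g)
    (a b : ℝ) :
    Tendsto (fun W : ℝ => ∫ Y in a..b, r ^ (Real.tanh (2 * Y / W) / 2) * g Y) (𝓝[>] 0)
      (𝓝 (∫ Y in a..b, r ^ (Real.sign Y / 2) * g Y)) := by
  refine tendsto_integral_filter_of_dominated_convergence
    (fun Y => Real.exp |Real.log r| * |g Y|) (Eventually.of_forall fun W => ?_)
    (Eventually.of_forall fun W => Eventually.of_forall fun Y _ => ?_)
    ((continuous_const.mul hg.abs).intervalIntegrable _ _) ?_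
  · have harg : Continuous fun Y : ℝ => Real.tanh (2 * Y / W) / 2 :=
      (continuous_real_tanh.comp (by fun_prop : Continuous fun Y : ℝ => 2 * Y / W)).div_const 2
    exact ((continuous_const.rpow harg fun _ => Or.inl hr.ne').mul hg).aestronglyMeasurable
  · rw [norm_mul, Real.norm_eq_abs, Real.norm_eq_abs, abs_of_pos (Real.rpow_pos_of_pos hr _)]
    exact mul_le_mul_of_nonneg_right (rpow_tanh_div_two_le hr _) (abs_nonneg _)
  · filter_upwards [MeasureTheory.volume.ae_ne 0] with Y hY _
    exact (((Real.continuous_const_rpow hr.ne').tendsto _).comp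
      ((tendsto_tanh_div_nhdsGT_zero hY).div_const 2)).mul_const _

theorem tendsto_integral_rpow_tanh_mul_split {r : ℝ} (hr : 0 < r) {g : ℝ → ℝ}
    (hg : Continuous g) {a b : ℝ} (ha : a ≤ 0) (hb : 0 ≤ b) :
    Tendsto (fun W : ℝ => ∫ Y in a..b, r ^ (Real.tanh (2 * Y / W) / 2) * g Y) (𝓝[>] 0)
      (𝓝 ((√r)⁻¹ * (∫ Y in a..0, g Y) + √r * ∫ Y in (0 : ℝ)..b, g Y)) := by
  have hneg : ∀ᵐ Y : ℝ, Y ∈ Set.uIoc a 0 → (√r)⁻¹ * g Y = r ^ (Real.sign Y / 2) * g Y := by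
    filter_upwards [MeasureTheory.volume.ae_ne 0] with Y hY hmem
    rw [Set.uIoc_of_le ha] at hmem
    rw [Real.sign_of_neg (lt_of_le_of_ne hmem.2 hY), neg_div, Real.rpow_neg hr.le,
      Real.sqrt_eq_rpow]
  have hpos : ∀ᵐ Y : ℝ, Y ∈ Set.uIoc 0 b → √r * g Y = r ^ (Real.sign Y / 2) * g Y := by
    filter_upwards with Y hmem
    rw [Set.uIoc_of_le hb] at hmem
    rw [Real.sign_of_pos hmem.1, Real.sqrt_eq_rpow]
  have hint_neg : IntervalIntegrable (fun Y => r ^ (Real.sign Y / 2) * g Y)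
      MeasureTheory.volume a 0 :=
    ((continuous_const.mul hg).intervalIntegrable a 0).congr_ae
      ((MeasureTheory.ae_restrict_iff' measurableSet_uIoc).2 hneg)
  have hint_pos : IntervalIntegrable (fun Y => r ^ (Real.sign Y / 2) * g Y)
      MeasureTheory.volume 0 b :=
    ((continuous_const.mul hg).intervalIntegrable 0 b).congr_ae
      ((MeasureTheory.ae_restrict_iff' measurableSet_uIoc).2 hpos)
  rw [← integral_const_mul, ← integral_const_mul, integral_congr_ae hneg, integral_congr_ae hpos,
    integral_add_adjacent_intervals hint_neg hint_pos]
  exact tendsto_integral_rpow_tanh_mul hr hg a b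

/-- Sharp-interface limit of the normalized interfacial viscous stress of the
M3 viscosity model: `τ*(W) = N(W)/D(W) → (r − 1)/(2(r + 1))` as `W → 0⁺`. -/
theorem M3_interfacial_stress_sharp_interface_limit
    (r : ℝ) (hr : 0 < r) :
    Tendsto
      (fun W : ℝ =>
        (∫ Y in (-1:ℝ)..1, r ^ (Real.tanh (2 * Y / W) / 2) * Y)
          / (∫ Y in (-1:ℝ)..1, r ^ (Real.tanh (2 * Y / W) / 2)))
      (𝓝[>] 0) (𝓝 ((r - 1) / (2 * (r + 1)))) := by
  have hs : 0 < √r := Real.sqrt_pos.2 hr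
  have hN := tendsto_integral_rpow_tanh_mul_split hr continuous_id
    (neg_nonpos.2 zero_le_one) zero_le_one
  have hD := tendsto_integral_rpow_tanh_mul_split hr (continuous_const (y := (1 : ℝ)))
    (neg_nonpos.2 zero_le_one) zero_le_one
  simp only [id, integral_id, integral_const, mul_one, smul_eq_mul] at hN hD
  have hval : (r - 1) / (2 * (r + 1)) = ((√r)⁻¹ * ((0 ^ 2 - (-1) ^ 2) / 2) +
      √r * ((1 ^ 2 - 0 ^ 2) / 2)) / ((√r)⁻¹ * (0 - -1) + √r * (1 - 0)) := by
    have hr_sq : r = √r ^ 2 := (Real.sq_sqrt hr.le).symm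
    generalize √r = s at hs hr_sq
    subst hr_sq
    norm_num
    field_simp
    ring
  rw [hval]
  exact hN.div hD (by norm_num; positivity)
end
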